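/- Fix m, n ≥ 1 and consider the graph on S = [m]^n with edges joining s and F_i(s) whenever F_i(s) ≠ 0, for i ∈ [m−1]. Let C be a connected component and let v ∈ C be its unique vertex with E_i(v) = 0 for all i ∈ [m−1]. Then Σ_{u ∈ C} x^{w(u)} = s_{w(v)}(x_1,…,x_m), the Schur polynomial of the partition w(v). -/

import Mathlib

/-! ### Crystal operators on words -/

/-- The number of `i`'s minus the number of `(i+1)`'s among the first `k` letters of `w`
(viewing each `i` as a closing parenthesis and each `i+1` as an opening parenthesis). -/
def prefD (i : ℕ) (w : List ℕ) (k : ℕ) : ℤ :=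
  ((w.take k).count i : ℤ) - ((w.take k).count (i + 1) : ℤ)

/-- The number of `(i+1)`'s minus the number of `i`'s in the suffix of `w` starting at
position `k`. -/
def suffD (i : ℕ) (w : List ℕ) (k : ℕ) : ℤ :=
  ((w.drop k).count (i + 1) : ℤ) - ((w.drop k).count i : ℤ)

/-- Position `p` of `w` holds a letter `i` which, viewed as a closing parenthesis
(each `i+1` being an opening parenthesis, all other letters ignored), is unmatched in the
usual parenthesis matching. -/
def IsUnmatchedClose (i : ℕ) (w : List ℕ) (p : ℕ) : Prop :=
  w[p]? = some i ∧ ∀ q ≤ p, prefD i w q < prefD i w (p + 1)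

/-- Position `p` of `w` holds a letter `i+1` which, viewed as an opening parenthesis
(each `i` being a closing parenthesis, all other letters ignored), is unmatched in the
usual parenthesis matching. -/
def IsUnmatchedOpen (i : ℕ) (w : List ℕ) (p : ℕ) : Prop :=
  w[p]? = some (i + 1) ∧ ∀ q ≤ w.length, p < q → suffD i w q < suffD i w p

instance (i : ℕ) (w : List ℕ) (p : ℕ) : Decidable (IsUnmatchedClose i w p) := by
  unfold IsUnmatchedClose; infer_instance

instance (i : ℕ) (w : List ℕ) (p : ℕ) : Decidable (IsUnmatchedOpen i w p) := by
  unfold IsUnmatchedOpen; infer_instance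

/-- The (increasing) list of positions of unmatched `i`'s (closing parentheses) of `w`. -/
def unmatchedCloses (i : ℕ) (w : List ℕ) : List ℕ :=
  (List.range w.length).filter fun p => decide (IsUnmatchedClose i w p)

/-- The (increasing) list of positions of unmatched `(i+1)`'s (opening parentheses) of `w`. -/
def unmatchedOpens (i : ℕ) (w : List ℕ) : List ℕ :=
  (List.range w.length).filter fun p => decide (IsUnmatchedOpen i w p)

/-- The crystal operator `F_i` on words: replace the rightmost unmatched `i` by `i+1`;
`none` (i.e. `0`) if every `i` is matched. -/
def Fop (i : ℕ) (w : List ℕ) : Option (List ℕ) :=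
  match (unmatchedCloses i w).getLast? with
  | none => none
  | some p => some (w.set p (i + 1))

/-- The crystal operator `E_i` on words: replace the leftmost unmatched `i+1` by `i`;
`none` (i.e. `0`) if every `i+1` is matched. -/
def Eop (i : ℕ) (w : List ℕ) : Option (List ℕ) :=
  match (unmatchedOpens i w).head? with
  | none => none
  | some p => some (w.set p i)

/-- `s` is a string over the alphabet `{1, …, m}`. -/
def IsWordOver (m : ℕ) (s : List ℕ) : Prop := ∀ x ∈ s, 1 ≤ x ∧ x ≤ m

/-- Two words are joined by an edge colored `i` (for some `i ∈ [m-1]`) of the crystal graph on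
words: one is the image of the other under `F_i`. -/
def wordEdge (m : ℕ) (u v : List ℕ) : Prop :=
  ∃ i, 1 ≤ i ∧ i < m ∧ (Fop i u = some v ∨ Fop i v = some u)

/-- `v` lies in the connected component of `u` in the crystal graph on words. -/
def wordComp (m : ℕ) (u v : List ℕ) : Prop :=
  Relation.ReflTransGen (wordEdge m) u v

/-! ### Partitions, semistandard Young tableaux and Schur polynomials -/

/-- `ν : ℕ → ℕ` encodes a partition `(ν 1, ν 2, …)` (the value `ν 0` is normalized to `0`):
the parts weakly decrease and only finitely many are nonzero. -/
def IsPartitionFn (ν : ℕ → ℕ) : Prop :=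
  ν 0 = 0 ∧ (∀ j, ν (j + 2) ≤ ν (j + 1)) ∧ ∃ N, ∀ j, N ≤ j → ν j = 0

/-- `S` is a semistandard Young tableau of shape `ν` with entries in `{1, …, m}`: the cells of
the shape are the `(r, c)` (0-based) with `c < ν (r+1)`; entries weakly increase along rows
and strictly increase down columns; `S` is normalized to be `0` outside the shape. -/
def IsSSYTFn (ν : ℕ → ℕ) (m : ℕ) (S : ℕ → ℕ → ℕ) : Prop :=
  (∀ r c, ¬ c < ν (r + 1) → S r c = 0) ∧
  (∀ r c, c < ν (r + 1) → 1 ≤ S r c ∧ S r c ≤ m) ∧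
  (∀ r c, c + 1 < ν (r + 1) → S r c ≤ S r (c + 1)) ∧
  (∀ r c, c < ν (r + 2) → S r c < S (r + 1) c)

/-- The monomial `x^S = ∏_j x_j^(number of entries of S equal to j)` of a semistandard Young
tableau `S` of shape `ν`. -/
noncomputable def ssytMonom (ν : ℕ → ℕ) (S : ℕ → ℕ → ℕ) : MvPolynomial ℕ ℤ :=
  ∏ᶠ j : ℕ, (MvPolynomial.X j : MvPolynomial ℕ ℤ) ^
    Nat.card {p : ℕ × ℕ // p.2 < ν (p.1 + 1) ∧ S p.1 p.2 = j}

/-- The Schur polynomial `s_ν(x_1, …, x_m)`: the sum of `x^S` over all semistandard Young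
tableaux `S` of shape `ν` with entries in `{1, …, m}`. -/
noncomputable def schurPoly (ν : ℕ → ℕ) (m : ℕ) : MvPolynomial ℕ ℤ :=
  ∑ᶠ S : {S : ℕ → ℕ → ℕ // IsSSYTFn ν m S}, ssytMonom ν S.1

/-! ### Recursive description of the crystal operators -/

/-- Number of unmatched `i`'s. -/
def cphi (i : ℕ) : List ℕ → ℕ
  | [] => 0
  | a :: t => if a = i then cphi i t + 1 else if a = i + 1 then cphi i t - 1 else cphi i t

/-- Number of unmatched `(i+1)`'s. -/
def ceps (i : ℕ) : List ℕ → ℕ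
  | [] => 0
  | a :: t => if a = i + 1 ∧ cphi i t = 0 then ceps i t + 1 else ceps i t

/-- Recursive version of `Fop`. -/
def cf (i : ℕ) : List ℕ → Option (List ℕ)
  | [] => none
  | a :: t =>
    if a = i ∧ cphi i t = 0 then some ((i + 1) :: t)
    else if a = i + 1 ∧ cphi i t ≤ 1 then none
    else (cf i t).map (fun s => a :: s)

/-- Recursive version of `Eop`. -/
def ce (i : ℕ) : List ℕ → Option (List ℕ)
  | [] => none
  | a :: t =>
    if a = i + 1 ∧ cphi i t = 0 then some (i :: t)
    else (ce i t).map (fun s => a :: s)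

theorem prefD_zero (i : ℕ) (w : List ℕ) : prefD i w 0 = 0 := by simp [prefD]

theorem prefD_cons (i a : ℕ) (t : List ℕ) (k : ℕ) :
    prefD i (a :: t) (k + 1) =
      prefD i t k + (if a = i then 1 else if a = i + 1 then -1 else 0) := by
  simp only [prefD, List.take_succ_cons, List.count_cons, beq_iff_eq]
  split_ifs <;> push_cast <;> omega

theorem prefD_le_cphi (i : ℕ) (w : List ℕ) : ∀ k, prefD i w k ≤ cphi i w := by
  induction w with
  | nil => intro k; simp [prefD, cphi]
  | cons a t ih =>
    intro k
    cases k with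
    | zero => rw [prefD_zero]; positivity
    | succ k =>
      rw [prefD_cons]
      have := ih k
      simp only [cphi]
      split_ifs <;> push_cast <;> omega

theorem suffD_eq (i : ℕ) (w : List ℕ) (k : ℕ) : suffD i w k = suffD i w 0 + prefD i w k := by
  have h : ∀ j, w.count j = (w.take k).count j + (w.drop k).count j := by
    intro j
    conv_lhs => rw [← List.take_append_drop k w, List.count_append]
  have h1 := h i
  have h2 := h (i + 1)
  simp only [suffD, prefD, List.drop_zero]
  omega

theorem exists_unmatchedOpen (i : ℕ) (w : List ℕ) (h : ceps i w ≠ 0) :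
    ∃ p, p < w.length ∧ IsUnmatchedOpen i w p := by
  induction w with
  | nil => simp [ceps] at h
  | cons a t ih =>
    by_cases hc : a = i + 1 ∧ cphi i t = 0
    · refine ⟨0, by simp, by simp [hc.1], ?_⟩
      intro q hq hq0
      obtain ⟨q, rfl⟩ : ∃ q', q = q' + 1 := ⟨q - 1, by omega⟩
      rw [suffD_eq, prefD_cons]
      have := prefD_le_cphi i t q
      rw [hc.2] at this
      simp [hc.1]
      push_cast at this
      omega
    · simp only [ceps, if_neg hc] at h
      obtain ⟨p, hp, h1, h2⟩ := ih h
      refine ⟨p + 1, by simpa using hp, by simpa using h1, ?_⟩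
      intro q hq hpq
      obtain ⟨q, rfl⟩ : ∃ q', q = q' + 1 := ⟨q - 1, by omega⟩
      have := h2 q (by simpa using hq) (by omega)
      simpa [suffD] using this

theorem ceps_eq_zero_of_Eop (i : ℕ) (w : List ℕ) (h : Eop i w = none) : ceps i w = 0 := by
  by_contra hc
  obtain ⟨p, hp, h1⟩ := exists_unmatchedOpen i w hc
  have hmem : p ∈ unmatchedOpens i w := by
    simp [unmatchedOpens, hp, h1]
  unfold Eop at h
  cases hh : (unmatchedOpens i w) with
  | nil => rw [hh] at hmem; simp at hmem
  | cons b l => rw [hh] at h; simp at h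

/-- Unmatched closes whose record value exceeds `k`. -/
def recs (i : ℕ) (w : List ℕ) (k : ℕ) : List ℕ :=
  (List.range w.length).filter fun p =>
    decide (IsUnmatchedClose i w p ∧ (k : ℤ) < prefD i w (p + 1))

theorem unmatchedCloses_eq (i : ℕ) (w : List ℕ) : unmatchedCloses i w = recs i w 0 := by
  unfold unmatchedCloses recs
  congr 1
  funext p
  rw [decide_eq_decide]
  constructor
  · intro h
    refine ⟨h, ?_⟩
    have := h.2 0 (by omega)
    rwa [prefD_zero] at this
  · exact fun h => h.1

theorem unmatchedClose_succ (i a : ℕ) (t : List ℕ) (p : ℕ) :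
    IsUnmatchedClose i (a :: t) (p + 1) ↔
      IsUnmatchedClose i t p ∧ 0 < prefD i (a :: t) (p + 2) := by
  unfold IsUnmatchedClose
  constructor
  · rintro ⟨h1, h2⟩
    refine ⟨⟨by simpa using h1, ?_⟩, ?_⟩
    · intro q hq
      have := h2 (q + 1) (by omega)
      rw [prefD_cons, prefD_cons] at this
      omega
    · have := h2 0 (by omega)
      rwa [prefD_zero] at this
  · rintro ⟨⟨h1, h2⟩, h3⟩
    refine ⟨by simpa using h1, ?_⟩
    intro q hq
    cases q with
    | zero => rwa [prefD_zero]
    | succ q =>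
      have := h2 q (by omega)
      rw [prefD_cons, prefD_cons]
      omega

theorem recs_cons (i a : ℕ) (t : List ℕ) (k : ℕ) :
    recs i (a :: t) k =
      (if a = i ∧ k = 0 then [0] else []) ++
        (recs i t (if a = i then k - 1 else if a = i + 1 then k + 1 else k)).map Nat.succ := by
  unfold recs
  rw [List.length_cons, List.range_succ_eq_map, List.filter_cons, List.filter_map]
  have h0 : (IsUnmatchedClose i (a :: t) 0 ∧ (k : ℤ) < prefD i (a :: t) (0 + 1)) ↔
      (a = i ∧ k = 0) := by
    unfold IsUnmatchedClose
    rw [prefD_cons, prefD_zero]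
    constructor
    · rintro ⟨⟨h1, h2⟩, h3⟩
      have : a = i := by simpa using h1
      rw [if_pos this] at h3
      exact ⟨this, by omega⟩
    · rintro ⟨h1, h2⟩
      refine ⟨⟨by simp [h1], ?_⟩, ?_⟩
      · intro q hq
        obtain rfl : q = 0 := by omega
        rw [prefD_zero, if_pos h1]; omega
      · rw [if_pos h1]; omega
  have hS : ∀ p, (IsUnmatchedClose i (a :: t) (p + 1) ∧
        (k : ℤ) < prefD i (a :: t) (p + 1 + 1)) ↔ (IsUnmatchedClose i t p ∧
        ((if a = i then k - 1 else if a = i + 1 then k + 1 else k : ℕ) : ℤ)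
          < prefD i t (p + 1)) := by
    intro p
    rw [unmatchedClose_succ, prefD_cons]
    have key : IsUnmatchedClose i t p → 0 < prefD i t (p + 1) := by
      intro h
      have := h.2 0 (by omega)
      rwa [prefD_zero] at this
    constructor
    · rintro ⟨⟨h1, h2⟩, h3⟩
      refine ⟨h1, ?_⟩
      have := key h1
      split_ifs at * <;> push_cast <;> omega
    · rintro ⟨h1, h3⟩
      have := key h1
      refine ⟨⟨h1, ?_⟩, ?_⟩ <;> split_ifs at * <;> push_cast at * <;> omega
  have hfun : ((fun p => decide (IsUnmatchedClose i (a :: t) p ∧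
        (k : ℤ) < prefD i (a :: t) (p + 1))) ∘ Nat.succ) = fun p =>
        decide (IsUnmatchedClose i t p ∧
        ((if a = i then k - 1 else if a = i + 1 then k + 1 else k : ℕ) : ℤ)
          < prefD i t (p + 1)) := by
    funext p
    simp only [Function.comp]
    rw [decide_eq_decide]
    exact hS p
  rw [hfun]
  simp only [h0]
  by_cases h : a = i ∧ k = 0
  · simp [h]
  · simp [h]

theorem recs_spec (i : ℕ) (w : List ℕ) : ∀ k,
    (cphi i w ≤ k → recs i w k = []) ∧
    (k < cphi i w → ∃ p, (recs i w k).getLast? = some p ∧ cf i w = some (w.set p (i + 1))) := by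
  induction w with
  | nil => intro k; simp [recs, cphi]
  | cons a t ih =>
    intro k
    rw [recs_cons]
    by_cases ha : a = i
    · subst ha
      simp only [cphi, cf, if_true, true_and]
      obtain ⟨h1, h2⟩ := ih (k - 1)
      constructor
      · intro hk
        rw [h1 (by omega), if_neg (by omega)]; rfl
      · intro hk
        by_cases h0 : cphi a t = 0
        · rw [h1 (by omega), if_pos (by omega), if_pos h0]
          exact ⟨0, by simp, by simp⟩
        · obtain ⟨p, hp, hp2⟩ := h2 (by omega)
          refine ⟨p + 1, ?_, ?_⟩
          · rw [List.getLast?_append, List.getLast?_map, hp]; rfl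
          · rw [if_neg h0, if_neg (by omega), hp2]; simp
    · by_cases hb : a = i + 1
      · simp only [cphi, cf, if_neg ha, if_pos hb]
        obtain ⟨h1, h2⟩ := ih (k + 1)
        constructor
        · intro hk
          rw [h1 (by omega), if_neg (by tauto)]; rfl
        · intro hk
          obtain ⟨p, hp, hp2⟩ := h2 (by omega)
          refine ⟨p + 1, ?_, ?_⟩
          · rw [List.getLast?_append, List.getLast?_map, hp]; rfl
          · rw [if_neg (by tauto), if_neg (by omega), hp2]; simp
      · simp only [cphi, cf, if_neg ha, if_neg hb]
        obtain ⟨h1, h2⟩ := ih k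
        constructor
        · intro hk
          rw [h1 (by omega), if_neg (by tauto)]; rfl
        · intro hk
          obtain ⟨p, hp, hp2⟩ := h2 (by omega)
          refine ⟨p + 1, ?_, ?_⟩
          · rw [List.getLast?_append, List.getLast?_map, hp]; rfl
          · rw [if_neg (by tauto), if_neg (by tauto), hp2]; simp

theorem cf_none_iff (i : ℕ) (w : List ℕ) : cf i w = none ↔ cphi i w = 0 := by
  induction w with
  | nil => simp [cf, cphi]
  | cons a t ih =>
    simp only [cf, cphi]
    split_ifs <;> simp_all <;> omega

theorem ce_none_iff (i : ℕ) (w : List ℕ) : ce i w = none ↔ ceps i w = 0 := by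
  induction w with
  | nil => simp [ce, ceps]
  | cons a t ih =>
    simp only [ce, ceps]
    split_ifs <;> simp_all

theorem Fop_eq (i : ℕ) (w : List ℕ) : Fop i w = cf i w := by
  unfold Fop
  rw [unmatchedCloses_eq]
  obtain ⟨h1, h2⟩ := recs_spec i w 0
  by_cases h : cphi i w = 0
  · rw [h1 (by omega), (cf_none_iff i w).2 h]; rfl
  · obtain ⟨p, hp, hp2⟩ := h2 (by omega)
    rw [hp, hp2]

/-! ### Tensor product rules -/

theorem cphi_ceps_append (i : ℕ) (u w : List ℕ) :
    cphi i (u ++ w) = cphi i u + (cphi i w - ceps i u) ∧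
    ceps i (u ++ w) = ceps i w + (ceps i u - cphi i w) := by
  induction u with
  | nil => simp [cphi, ceps]
  | cons a t ih =>
    simp only [List.cons_append, cphi, ceps, ih.1, ih.2]
    split_ifs <;> omega

theorem cphi_append (i : ℕ) (u w : List ℕ) :
    cphi i (u ++ w) = cphi i u + (cphi i w - ceps i u) := (cphi_ceps_append i u w).1

theorem ceps_append (i : ℕ) (u w : List ℕ) :
    ceps i (u ++ w) = ceps i w + (ceps i u - cphi i w) := (cphi_ceps_append i u w).2

theorem cf_append (i : ℕ) (u w : List ℕ) :
    cf i (u ++ w) = if ceps i u < cphi i w then (cf i w).map (fun s => u ++ s)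
      else (cf i u).map (fun s => s ++ w) := by
  induction u with
  | nil =>
    by_cases h : 0 < cphi i w
    · simp [ceps, h]
    · simp [ceps, h, cf, (cf_none_iff i w)]; omega
  | cons a t ih =>
    have hn := cf_none_iff i t
    have hw := cf_none_iff i w
    simp only [List.cons_append, cf, ceps, ih, cphi_append]
    by_cases ht : cphi i t = 0
    · rw [hn.2 ht]
      by_cases hw0 : cphi i w = 0
      · rw [hw.2 hw0]
        split_ifs <;> simp <;> omega
      · obtain ⟨w', hw'⟩ := Option.ne_none_iff_exists'.1 (fun h => hw0 (hw.1 h))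
        rw [hw']
        split_ifs <;> simp <;> omega
    · obtain ⟨t', ht'⟩ := Option.ne_none_iff_exists'.1 (fun h => ht (hn.1 h))
      rw [ht']
      by_cases hw0 : cphi i w = 0
      · rw [hw.2 hw0]
        split_ifs <;> simp <;> omega
      · obtain ⟨w', hw'⟩ := Option.ne_none_iff_exists'.1 (fun h => hw0 (hw.1 h))
        rw [hw']
        split_ifs <;> simp <;> omega

theorem ce_append (i : ℕ) (u w : List ℕ) :
    ce i (u ++ w) = if cphi i w < ceps i u then (ce i u).map (fun s => s ++ w)
      else (ce i w).map (fun s => u ++ s) := by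
  induction u with
  | nil => simp [ceps]
  | cons a t ih =>
    have hn := ce_none_iff i t
    simp only [List.cons_append, ce, ceps, ih, cphi_append]
    by_cases ht : ceps i t = 0
    · rw [hn.2 ht]
      split_ifs <;> simp <;> first | omega | rfl
    · obtain ⟨t', ht'⟩ := Option.ne_none_iff_exists'.1 (fun h => ht (hn.1 h))
      rw [ht']
      split_ifs <;> simp <;> first | omega | rfl

theorem cf_stats (i : ℕ) (w : List ℕ) : ∀ w', cf i w = some w' →
    cphi i w = cphi i w' + 1 ∧ ceps i w' = ceps i w + 1 ∧ ce i w' = some w := by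
  induction w with
  | nil => intro w' h; simp [cf] at h
  | cons a t ih =>
    intro w' h
    simp only [cf] at h
    split_ifs at h with h1 h2
    · simp only [Option.some.injEq] at h
      subst h
      simp [cphi, ceps, ce, h1]
    · simp only [Option.map_eq_some_iff] at h
      obtain ⟨t', ht', rfl⟩ := h
      obtain ⟨ha, hb, hc⟩ := ih t' ht'
      simp only [cphi, ceps, ce, hc]
      refine ⟨?_, ?_, ?_⟩
      · split_ifs <;> omega
      · split_ifs <;> omega
      · rw [if_neg (by omega)]; rfl

theorem ce_stats (i : ℕ) (w : List ℕ) : ∀ w', ce i w = some w' →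
    cphi i w' = cphi i w + 1 ∧ ceps i w = ceps i w' + 1 ∧ cf i w' = some w := by
  induction w with
  | nil => intro w' h; simp [ce] at h
  | cons a t ih =>
    intro w' h
    simp only [ce] at h
    split_ifs at h with h1
    · simp only [Option.some.injEq] at h
      subst h
      simp [cphi, ceps, cf, h1]
    · simp only [Option.map_eq_some_iff] at h
      obtain ⟨t', ht', rfl⟩ := h
      obtain ⟨ha, hb, hc⟩ := ih t' ht'
      simp only [cphi, ceps, cf, hc]
      refine ⟨?_, ?_, ?_⟩
      · split_ifs <;> omega
      · split_ifs <;> omega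
      · rw [if_neg (by omega), if_neg (by omega)]; rfl

theorem ce_iff_cf (i : ℕ) (u w : List ℕ) : ce i u = some w ↔ cf i w = some u :=
  ⟨fun h => (ce_stats i u w h).2.2, fun h => (cf_stats i w u h).2.2⟩

/-! ### Knuth equivalence -/

/-- Knuth (plactic) equivalence of words. -/
inductive KEq : List ℕ → List ℕ → Prop
  | refl (u : List ℕ) : KEq u u
  | symm {u w : List ℕ} : KEq u w → KEq w u
  | trans {u v w : List ℕ} : KEq u v → KEq v w → KEq u w
  | k1 {x y z : ℕ} : x ≤ y → y < z → KEq [x, z, y] [z, x, y]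
  | k2 {x y z : ℕ} : x < y → y ≤ z → KEq [y, z, x] [y, x, z]
  | append {a c b d : List ℕ} : KEq a c → KEq b d → KEq (a ++ b) (c ++ d)

/-- Lifting of Knuth equivalence to optional words. -/
def OKEq : Option (List ℕ) → Option (List ℕ) → Prop
  | none, none => True
  | some u, some w => KEq u w
  | _, _ => False

theorem OKEq.rfl' (o : Option (List ℕ)) : OKEq o o := by
  cases o with
  | none => trivial
  | some u => exact KEq.refl u

theorem OKEq.symm' {o p : Option (List ℕ)} (h : OKEq o p) : OKEq p o := by
  cases o <;> cases p <;> simp_all [OKEq, KEq.symm]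

theorem OKEq.trans' {o p q : Option (List ℕ)} (h : OKEq o p) (h' : OKEq p q) : OKEq o q := by
  cases o <;> cases p <;> cases q <;> simp_all [OKEq]
  exact h.trans h'

theorem OKEq.appL {a a' : List ℕ} {o p : Option (List ℕ)} (ha : KEq a a') (h : OKEq o p) :
    OKEq (o.map (fun s => a ++ s)) (p.map (fun s => a' ++ s)) := by
  cases o <;> cases p <;> simp_all [OKEq]
  exact KEq.append ha h

theorem OKEq.appR {b b' : List ℕ} {o p : Option (List ℕ)} (hb : KEq b b') (h : OKEq o p) :
    OKEq (o.map (fun s => s ++ b)) (p.map (fun s => s ++ b')) := by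
  cases o <;> cases p <;> simp_all [OKEq]
  exact KEq.append h hb

theorem KEq.perm {u w : List ℕ} (h : KEq u w) : u.Perm w := by
  induction h with
  | refl u => exact List.Perm.refl u
  | symm _ ih => exact ih.symm
  | trans _ _ ih1 ih2 => exact ih1.trans ih2
  | k1 _ _ => exact List.Perm.swap _ _ _
  | k2 _ _ => exact (List.Perm.swap _ _ _).cons _
  | append _ _ ih1 ih2 => exact ih1.append ih2

theorem KEq.k1_bisim (i : ℕ) {x y z : ℕ} (h1 : x ≤ y) (h2 : y < z) :
    cphi i [x, z, y] = cphi i [z, x, y] ∧ ceps i [x, z, y] = ceps i [z, x, y] ∧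
    OKEq (cf i [x, z, y]) (cf i [z, x, y]) ∧ OKEq (ce i [x, z, y]) (ce i [z, x, y]) := by
  rcases (by omega : x = i ∨ x = i + 1 ∨ (x ≠ i ∧ x ≠ i + 1)) with hx | hx | ⟨hx, hx'⟩ <;>
  rcases (by omega : y = i ∨ y = i + 1 ∨ (y ≠ i ∧ y ≠ i + 1)) with hy | hy | ⟨hy, hy'⟩ <;>
  rcases (by omega : z = i ∨ z = i + 1 ∨ (z ≠ i ∧ z ≠ i + 1)) with hz | hz | ⟨hz, hz'⟩ <;>
  first
  | (exfalso; omega)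
  | (simp [cphi, ceps, cf, ce, OKEq, *] <;>
      first
      | exact KEq.k1 (by omega) (by omega)
      | exact KEq.k2 (by omega) (by omega)
      | exact ⟨KEq.k1 (by omega) (by omega), KEq.k1 (by omega) (by omega)⟩)

theorem KEq.k2_bisim (i : ℕ) {x y z : ℕ} (h1 : x < y) (h2 : y ≤ z) :
    cphi i [y, z, x] = cphi i [y, x, z] ∧ ceps i [y, z, x] = ceps i [y, x, z] ∧
    OKEq (cf i [y, z, x]) (cf i [y, x, z]) ∧ OKEq (ce i [y, z, x]) (ce i [y, x, z]) := by
  rcases (by omega : x = i ∨ x = i + 1 ∨ (x ≠ i ∧ x ≠ i + 1)) with hx | hx | ⟨hx, hx'⟩ <;>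
  rcases (by omega : y = i ∨ y = i + 1 ∨ (y ≠ i ∧ y ≠ i + 1)) with hy | hy | ⟨hy, hy'⟩ <;>
  rcases (by omega : z = i ∨ z = i + 1 ∨ (z ≠ i ∧ z ≠ i + 1)) with hz | hz | ⟨hz, hz'⟩ <;>
  first
  | (exfalso; omega)
  | (simp [cphi, ceps, cf, ce, OKEq, *] <;>
      first
      | exact KEq.k2 (by omega) (by omega)
      | exact KEq.k1 (by omega) (by omega)
      | exact ⟨KEq.k2 (by omega) (by omega), KEq.k2 (by omega) (by omega)⟩)

theorem KEq.bisim (i : ℕ) {u w : List ℕ} (h : KEq u w) :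
    cphi i u = cphi i w ∧ ceps i u = ceps i w ∧
    OKEq (cf i u) (cf i w) ∧ OKEq (ce i u) (ce i w) := by
  induction h with
  | refl u => exact ⟨rfl, rfl, OKEq.rfl' _, OKEq.rfl' _⟩
  | symm _ ih => exact ⟨ih.1.symm, ih.2.1.symm, ih.2.2.1.symm', ih.2.2.2.symm'⟩
  | trans _ _ ih1 ih2 =>
    exact ⟨ih1.1.trans ih2.1, ih1.2.1.trans ih2.2.1, ih1.2.2.1.trans' ih2.2.2.1,
      ih1.2.2.2.trans' ih2.2.2.2⟩
  | k1 h1 h2 => exact KEq.k1_bisim i h1 h2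
  | k2 h1 h2 => exact KEq.k2_bisim i h1 h2
  | append ha hb ih1 ih2 =>
    obtain ⟨a1, a2, a3, a4⟩ := ih1
    obtain ⟨b1, b2, b3, b4⟩ := ih2
    refine ⟨?_, ?_, ?_, ?_⟩
    · rw [cphi_append, cphi_append, a1, a2, b1]
    · rw [ceps_append, ceps_append, a2, b1, b2]
    · rw [cf_append, cf_append, a2, b1]
      split_ifs
      · exact OKEq.appL ha b3
      · exact OKEq.appR hb a3
    · rw [ce_append, ce_append, a2, b1]
      split_ifs
      · exact OKEq.appR hb a4
      · exact OKEq.appL ha b4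

theorem KEq.cons (a : ℕ) {u w : List ℕ} (h : KEq u w) : KEq (a :: u) (a :: w) :=
  KEq.append (KEq.refl [a]) h

theorem KEq.cf_some {i : ℕ} {u w u' : List ℕ} (h : KEq u w) (hu : cf i u = some u') :
    ∃ w', cf i w = some w' ∧ KEq u' w' := by
  have := (h.bisim i).2.2.1
  rw [hu] at this
  cases hw : cf i w with
  | none => rw [hw] at this; exact this.elim
  | some z => rw [hw] at this; exact ⟨z, rfl, this⟩

theorem KEq.ce_some {i : ℕ} {u w u' : List ℕ} (h : KEq u w) (hu : ce i u = some u') :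
    ∃ w', ce i w = some w' ∧ KEq u' w' := by
  have := (h.bisim i).2.2.2
  rw [hu] at this
  cases hw : ce i w with
  | none => rw [hw] at this; exact this.elim
  | some z => rw [hw] at this; exact ⟨z, rfl, this⟩

/-! ### Superstandard column words -/

/-- The column `k, k-1, …, 1`. -/
def scol : ℕ → List ℕ
  | 0 => []
  | k + 1 => (k + 1) :: scol k

theorem scol_slide (k : ℕ) : ∀ y z, k < y → y ≤ z → KEq (y :: z :: scol k) (y :: (scol k ++ [z])) := by
  induction k with
  | zero => intro y z _ _; exact KEq.refl _
  | succ k ih =>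
    intro y z h1 h2
    have e1 : KEq (y :: z :: scol (k + 1)) (y :: (k + 1) :: z :: scol k) :=
      KEq.append (KEq.k2 h1 h2) (KEq.refl (scol k))
    exact e1.trans ((ih (k + 1) z (by omega) (by omega)).cons y)

theorem scol_comm (h : ℕ) : ∀ a, 1 ≤ a → a ≤ h → KEq (a :: scol h) (scol h ++ [a]) := by
  induction h with
  | zero => intro a h1 h2; omega
  | succ h ih =>
    intro a h1 h2
    by_cases ha : a = h + 1
    · subst ha
      exact scol_slide h (h + 1) (h + 1) (by omega) le_rfl
    · obtain ⟨k, rfl⟩ : ∃ k, h = k + 1 := ⟨h - 1, by omega⟩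
      have e1 : KEq (a :: scol (k + 1 + 1)) ((k + 1 + 1) :: a :: scol (k + 1)) :=
        KEq.append (KEq.k1 (by omega : a ≤ k + 1) (by omega)) (KEq.refl (scol k))
      exact e1.trans ((ih a h1 (by omega)).cons _)

theorem mem_scol {k x : ℕ} : x ∈ scol k ↔ 1 ≤ x ∧ x ≤ k := by
  induction k with
  | zero => simp [scol]; omega
  | succ k ih => simp [scol, ih]; omega

theorem scol_sorted (k : ℕ) : (scol k).Pairwise (· > ·) := by
  induction k with
  | zero => simp [scol]
  | succ k ih =>
    simp only [scol, List.pairwise_cons]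
    refine ⟨?_, ih⟩
    intro x hx
    rw [mem_scol] at hx
    omega

theorem scol_length (k : ℕ) : (scol k).length = k := by
  induction k with
  | zero => simp [scol]
  | succ k ih => simp [scol, ih]

/-- The superstandard word with column heights `H`. -/
def sword (H : List ℕ) : List ℕ := (H.map scol).flatten

theorem scol_stats (i k : ℕ) (hi : 1 ≤ i) :
    cphi i (scol k) = (if k = i then 1 else 0) ∧ ceps i (scol k) = 0 := by
  induction k with
  | zero => simp [scol, cphi, ceps]; omega
  | succ k ih =>
    simp only [scol, cphi, ceps, ih.1, ih.2]
    constructor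
    · split_ifs <;> omega
    · rw [if_neg]; rintro ⟨h1, h2⟩; rw [if_pos (by omega)] at h2; omega

theorem cphi_sword (i : ℕ) (hi : 1 ≤ i) (H : List ℕ) : cphi i (sword H) = H.count i := by
  induction H with
  | nil => simp [sword, cphi]
  | cons h H ih =>
    have : sword (h :: H) = scol h ++ sword H := by simp [sword]
    rw [this, cphi_append, (scol_stats i h hi).1, (scol_stats i h hi).2, ih, List.count_cons]
    simp only [beq_iff_eq]
    split_ifs <;> omega

theorem sword_insert (a : ℕ) (ha : 1 ≤ a) (H : List ℕ) : H.Pairwise (· ≥ ·) →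
    (∀ h ∈ H, 1 ≤ h) → (a = 1 ∨ a - 1 ∈ H) →
    ∃ H' : List ℕ, H'.Pairwise (· ≥ ·) ∧ (∀ h ∈ H', 1 ≤ h) ∧ (∀ h ∈ H', h = a ∨ h ∈ H) ∧
      KEq (a :: sword H) (sword H') := by
  induction H with
  | nil =>
    intro _ _ h
    obtain rfl : a = 1 := by simpa using h
    exact ⟨[1], by simp, by simp, by simp, by simp [sword, scol]; exact KEq.refl _⟩
  | cons h H ih =>
    intro hs hp hm
    rw [List.pairwise_cons] at hs
    have e : ∀ (h : ℕ) (H : List ℕ), sword (h :: H) = scol h ++ sword H := by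
      intro h H; simp [sword]
    have hh : 1 ≤ h := hp h (by simp)
    by_cases hah : a ≤ h
    · have hm' : a = 1 ∨ a - 1 ∈ H := by
        rcases hm with hm | hm
        · exact Or.inl hm
        · rw [List.mem_cons] at hm
          rcases hm with hm | hm
          · omega
          · exact Or.inr hm
      obtain ⟨H', h1, h2, h3, h4⟩ := ih hs.2 (fun x hx => hp x (by simp [hx])) hm'
      refine ⟨h :: H', ?_, ?_, ?_, ?_⟩
      · rw [List.pairwise_cons]
        refine ⟨?_, h1⟩
        intro x hx
        rcases h3 x hx with rfl | hx
        · exact hah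
        · exact hs.1 x hx
      · intro x hx
        rw [List.mem_cons] at hx
        rcases hx with rfl | hx
        · exact hh
        · exact h2 x hx
      · intro x hx
        rw [List.mem_cons] at hx
        rcases hx with rfl | hx
        · simp
        · rcases h3 x hx with h | h <;> simp [h]
      · rw [e, e]
        have e1 : KEq (a :: (scol h ++ sword H)) (scol h ++ (a :: sword H)) := by
          have := KEq.append (scol_comm h a ha hah) (KEq.refl (sword H))
          simpa using this
        exact e1.trans (KEq.append (KEq.refl _) h4)
    · have hha : h + 1 = a := by
        rcases hm with hm | hm
        · omega
        · rw [List.mem_cons] at hm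
          rcases hm with hm | hm
          · omega
          · have := hs.1 _ hm
            omega
      subst hha
      refine ⟨(h + 1) :: H, ?_, ?_, ?_, ?_⟩
      · rw [List.pairwise_cons]
        exact ⟨fun x hx => le_trans (hs.1 x hx) (by omega), hs.2⟩
      · intro x hx
        rw [List.mem_cons] at hx
        rcases hx with rfl | hx
        · omega
        · exact hp x (by simp [hx])
      · intro x hx
        rw [List.mem_cons] at hx
        rcases hx with rfl | hx
        · simp
        · simp [hx]
      · rw [e, e]
        exact KEq.refl _

/-- Highest weight words. -/
def IsHW (m : ℕ) (w : List ℕ) : Prop := ∀ i, 1 ≤ i → i < m → ceps i w = 0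

theorem IsHW.tail {m a : ℕ} {t : List ℕ} (h : IsHW m (a :: t)) : IsHW m t := by
  intro i h1 h2
  have := h i h1 h2
  simp only [ceps] at this
  split_ifs at this
  exact this

theorem hw_keq_sword (m : ℕ) (v : List ℕ) : IsWordOver m v → IsHW m v →
    ∃ H : List ℕ, H.Pairwise (· ≥ ·) ∧ (∀ h ∈ H, 1 ≤ h) ∧ KEq v (sword H) := by
  induction v with
  | nil => intro _ _; exact ⟨[], by simp, by simp, KEq.refl _⟩
  | cons a t ih =>
    intro hv hh
    obtain ⟨H, h1, h2, h3⟩ := ih (fun x hx => hv x (by simp [hx])) hh.tail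
    have ha := hv a (by simp)
    have hm : a = 1 ∨ a - 1 ∈ H := by
      by_cases ha1 : a = 1
      · exact Or.inl ha1
      · right
        have hc := hh (a - 1) (by omega) (by omega)
        simp only [ceps] at hc
        split_ifs at hc with hd
        have : cphi (a - 1) t ≠ 0 := by
          intro h0; exact hd ⟨by omega, h0⟩
        rw [(h3.bisim (a - 1)).1, cphi_sword _ (by omega)] at this
        exact List.count_pos_iff.1 (by omega)
    obtain ⟨H1, hh1, hh2, _, hh4⟩ := sword_insert a ha.1 H h1 h2 hm
    exact ⟨H1, hh1, hh2, (h3.cons a).trans hh4⟩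

/-! ### Column-strict words -/

theorem col_stats (i : ℕ) (c : List ℕ) : c.Pairwise (· > ·) →
    cphi i c = (if i ∈ c ∧ i + 1 ∉ c then 1 else 0) ∧
    ceps i c = (if i + 1 ∈ c ∧ i ∉ c then 1 else 0) := by
  induction c with
  | nil => intro _; simp [cphi, ceps]
  | cons a t ih =>
    intro h
    rw [List.pairwise_cons] at h
    obtain ⟨h1, h2⟩ := ih h.2
    have ha : ∀ x, x ∈ t → x < a := h.1
    have hi := ha i
    have hi1 := ha (i + 1)
    simp only [cphi, ceps, h1, h2, List.mem_cons]
    clear ih h ha h1 h2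
    grind

theorem cf_mem (i : ℕ) (w : List ℕ) : ∀ w', cf i w = some w' →
    (∀ x ∈ w', x ∈ w ∨ x = i + 1) ∧ w'.length = w.length ∧
    ∀ k, w.countP (· < k) = w'.countP (· < k) + (if k = i + 1 then 1 else 0) := by
  induction w with
  | nil => intro w' h; simp [cf] at h
  | cons a t ih =>
    intro w' h
    simp only [cf] at h
    split_ifs at h with h1 h2
    · simp only [Option.some.injEq] at h
      subst h
      obtain ⟨rfl, _⟩ := h1
      refine ⟨?_, by simp, ?_⟩
      · intro x hx
        simp only [List.mem_cons] at hx ⊢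
        tauto
      · intro k
        simp only [List.countP_cons, decide_eq_true_eq]
        split_ifs <;> omega
    · simp only [Option.map_eq_some_iff] at h
      obtain ⟨t', ht', rfl⟩ := h
      obtain ⟨ha, hb, hc⟩ := ih t' ht'
      refine ⟨?_, by simp [hb], ?_⟩
      · intro x hx
        simp only [List.mem_cons] at hx ⊢
        rcases hx with hx | hx
        · tauto
        · have := ha x hx; tauto
      · intro k
        simp only [List.countP_cons, hc k]
        omega

theorem ce_mem (i : ℕ) (w : List ℕ) : ∀ w', ce i w = some w' →
    (∀ x ∈ w', x ∈ w ∨ x = i) := by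
  induction w with
  | nil => intro w' h; simp [ce] at h
  | cons a t ih =>
    intro w' h
    simp only [ce] at h
    split_ifs at h with h1
    · simp only [Option.some.injEq] at h
      subst h
      intro x hx
      simp only [List.mem_cons] at hx ⊢
      tauto
    · simp only [Option.map_eq_some_iff] at h
      obtain ⟨t', ht', rfl⟩ := h
      intro x hx
      simp only [List.mem_cons] at hx ⊢
      rcases hx with hx | hx
      · tauto
      · have := ih t' ht' x hx; tauto

theorem ce_sum (i : ℕ) (w : List ℕ) : ∀ w', ce i w = some w' → w'.sum < w.sum := by
  induction w with
  | nil => intro w' h; simp [ce] at h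
  | cons a t ih =>
    intro w' h
    simp only [ce] at h
    split_ifs at h with h1
    · simp only [Option.some.injEq] at h
      subst h
      simp [h1.1]
    · simp only [Option.map_eq_some_iff] at h
      obtain ⟨t', ht', rfl⟩ := h
      have := ih t' ht'
      simpa using this

theorem cf_sorted (i : ℕ) (c c' : List ℕ) (hc : c.Pairwise (· > ·)) (h : cf i c = some c') :
    c'.Pairwise (· > ·) := by
  induction c generalizing c' with
  | nil => simp [cf] at h
  | cons a t ih =>
    have hs := col_stats i t
    rw [List.pairwise_cons] at hc
    have hst := (hs hc.2).1
    simp only [cf] at h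
    split_ifs at h with h1 h2
    · simp only [Option.some.injEq] at h
      subst h
      rw [List.pairwise_cons]
      refine ⟨?_, hc.2⟩
      intro x hx
      have := hc.1 x hx
      omega
    · simp only [Option.map_eq_some_iff] at h
      obtain ⟨t', ht', rfl⟩ := h
      rw [List.pairwise_cons]
      refine ⟨?_, ih t' hc.2 ht'⟩
      have hpos : cphi i t ≠ 0 := by
        rw [(cf_stats i t t' ht').1]; omega
      have hmem : i ∈ t := by
        by_contra hn
        rw [if_neg (by tauto)] at hst
        exact hpos hst
      have hle : cphi i t ≤ 1 := by rw [hst]; split_ifs <;> omega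
      have := hc.1 i hmem
      intro x hx
      rcases (cf_mem i t t' ht').1 x hx with h' | h'
      · exact hc.1 x h'
      · have : a ≠ i + 1 := fun h => h2 ⟨h, hle⟩
        omega

theorem ce_sorted (i : ℕ) (c c' : List ℕ) (hc : c.Pairwise (· > ·)) (h : ce i c = some c') :
    c'.Pairwise (· > ·) := by
  induction c generalizing c' with
  | nil => simp [ce] at h
  | cons a t ih =>
    have hs := col_stats i t
    rw [List.pairwise_cons] at hc
    have hst := hs hc.2
    simp only [ce] at h
    split_ifs at h with h1
    · simp only [Option.some.injEq] at h
      subst h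
      rw [List.pairwise_cons]
      refine ⟨?_, hc.2⟩
      intro x hx
      have hx1 := hc.1 x hx
      have hi1 : i + 1 ∉ t := fun hm => by have := hc.1 _ hm; omega
      have hxi : x ≠ i := by
        rintro rfl
        rw [if_pos ⟨hx, hi1⟩] at hst
        omega
      omega
    · simp only [Option.map_eq_some_iff] at h
      obtain ⟨t', ht', rfl⟩ := h
      rw [List.pairwise_cons]
      refine ⟨?_, ih t' hc.2 ht'⟩
      have hpos : ceps i t ≠ 0 := by
        rw [(ce_stats i t t' ht').2.1]; omega
      have hmem : i + 1 ∈ t := by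
        by_contra hn
        rw [if_neg (by tauto : ¬ (i + 1 ∈ t ∧ i ∉ t))] at hst
        exact hpos hst.2
      have := hc.1 _ hmem
      intro x hx
      rcases ce_mem i t t' ht' x hx with hx2 | hx2
      · exact hc.1 x hx2
      · omega

/-- Compatibility of two columns (rows weakly increase), phrased through counting. -/
def Compat (c d : List ℕ) : Prop := ∀ k, d.countP (· < k) ≤ c.countP (· < k)

theorem Compat.trans {a b c : List ℕ} (h : Compat a b) (h' : Compat b c) : Compat a c :=
  fun k => (h' k).trans (h k)

theorem countP_lt_succ (c : List ℕ) (k : ℕ) :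
    c.countP (· < k + 1) = c.countP (· < k) + c.count k := by
  induction c with
  | nil => simp
  | cons a t ih =>
    simp only [List.countP_cons, List.count_cons, ih, decide_eq_true_eq, beq_iff_eq]
    split_ifs <;> omega

theorem sorted_count {c : List ℕ} (hc : c.Pairwise (· > ·)) (k : ℕ) :
    c.count k = if k ∈ c then 1 else 0 := by
  have hn : c.Nodup := hc.imp (fun h => by omega)
  split_ifs with h
  · exact List.count_eq_one_of_mem hn h
  · exact List.count_eq_zero_of_not_mem h

theorem compat_cf {i : ℕ} {c c' d : List ℕ} (hc : c.Pairwise (· > ·)) (hd : d.Pairwise (· > ·))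
    (h : Compat c d) (hf : cf i c = some c') (hphi : cphi i d = 0) : Compat c' d := by
  intro k
  have hk := h k
  have e := (cf_mem i c c' hf).2.2 k
  by_cases hki : k = i + 1
  · subst hki
    rw [if_pos rfl] at e
    have e0 := h i
    have e2 := h (i + 1 + 1)
    have hcp := (cf_stats i c c' hf).1
    rw [(col_stats i c hc).1] at hcp
    rw [(col_stats i d hd).1] at hphi
    rw [countP_lt_succ _ (i + 1), countP_lt_succ _ (i + 1)] at e2
    have s1 := countP_lt_succ c i
    have s2 := countP_lt_succ d i
    rw [sorted_count hc] at s1 e2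
    rw [sorted_count hd] at s2 e2
    split_ifs at * <;> first | omega | (exfalso; tauto)
  · rw [if_neg hki] at e
    omega

theorem compat_ce {i : ℕ} {c d d' : List ℕ} (hc : c.Pairwise (· > ·)) (hd : d.Pairwise (· > ·))
    (h : Compat c d) (he : ce i d = some d') (heps : ceps i c = 0) : Compat c d' := by
  intro k
  have hk := h k
  have e := (cf_mem i d' d ((ce_iff_cf i d d').1 he)).2.2 k
  by_cases hki : k = i + 1
  · subst hki
    rw [if_pos rfl] at e
    have e0 := h i
    have e2 := h (i + 1 + 1)
    have hcp := (ce_stats i d d' he).2.1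
    rw [(col_stats i d hd).2] at hcp
    rw [(col_stats i c hc).2] at heps
    rw [countP_lt_succ _ (i + 1), countP_lt_succ _ (i + 1)] at e2
    have s1 := countP_lt_succ c i
    have s2 := countP_lt_succ d i
    rw [sorted_count hc] at s1 e2
    rw [sorted_count hd] at s2 e2
    split_ifs at * <;> first | omega | (exfalso; tauto)
  · rw [if_neg hki] at e
    omega

theorem compat_of_cf {i : ℕ} {c c' : List ℕ} (hf : cf i c = some c') : Compat c c' := by
  intro k
  have e := (cf_mem i c c' hf).2.2 k
  omega

/-- Lists of columns of semistandard tableaux. -/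
def Good (cs : List (List ℕ)) : Prop :=
  (∀ c ∈ cs, c.Pairwise (· > ·)) ∧ cs.IsChain Compat

theorem good_cons {c : List ℕ} {cs : List (List ℕ)} :
    Good (c :: cs) ↔ c.Pairwise (· > ·) ∧ (∀ d ∈ cs.head?, Compat c d) ∧ Good cs := by
  unfold Good
  rw [List.isChain_cons]
  simp only [List.forall_mem_cons]
  tauto

theorem good_cf (i : ℕ) (cs : List (List ℕ)) : Good cs → ∀ w, cf i cs.flatten = some w →
    ∃ cs', Good cs' ∧ cs'.map List.length = cs.map List.length ∧ cs'.flatten = w ∧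
      ∀ d' ∈ cs'.head?, ∃ d ∈ cs.head?, Compat d d' := by
  induction cs with
  | nil => intro _ w h; simp [cf] at h
  | cons c cs ih =>
    intro hg w h
    rw [good_cons] at hg
    obtain ⟨g1, g2, g3⟩ := hg
    rw [List.flatten_cons, cf_append] at h
    split_ifs at h with hlt
    · simp only [Option.map_eq_some_iff] at h
      obtain ⟨s, hs, rfl⟩ := h
      obtain ⟨cs', k1, k2, k3, k4⟩ := ih g3 s hs
      refine ⟨c :: cs', ?_, by simp [k2], by simp [k3], ?_⟩
      · rw [good_cons]
        refine ⟨g1, ?_, k1⟩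
        intro d' hd'
        obtain ⟨d, hd, hdd⟩ := k4 d' hd'
        exact (g2 d hd).trans hdd
      · intro d' hd'
        simp only [List.head?_cons, Option.mem_def, Option.some.injEq] at hd'
        subst hd'
        exact ⟨c, by simp, fun k => le_rfl⟩
    · simp only [Option.map_eq_some_iff] at h
      obtain ⟨c', hc', rfl⟩ := h
      refine ⟨c' :: cs, ?_, by simp [(cf_mem i c c' hc').2.1], by simp, ?_⟩
      · rw [good_cons]
        refine ⟨cf_sorted i c c' g1 hc', ?_, g3⟩
        intro d hd
        have hd0 : d.Pairwise (· > ·) := g3.1 d (List.mem_of_mem_head? hd)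
        refine compat_cf g1 hd0 (g2 d hd) hc' ?_
        cases cs with
        | nil => simp at hd
        | cons d0 cs =>
          simp only [List.head?_cons, Option.mem_def, Option.some.injEq] at hd
          subst hd
          rw [List.flatten_cons, cphi_append] at hlt
          have hcp := (cf_stats i c c' hc').1
          rw [(col_stats i c g1).1] at hcp
          rw [(col_stats i c g1).2] at hlt
          split_ifs at hcp hlt <;> first | omega | (exfalso; tauto)
      · intro d' hd'
        simp only [List.head?_cons, Option.mem_def, Option.some.injEq] at hd'
        subst hd'
        exact ⟨c, by simp, compat_of_cf hc'⟩

theorem good_ce (i : ℕ) (cs : List (List ℕ)) : Good cs → ∀ w, ce i cs.flatten = some w →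
    ∃ cs', Good cs' ∧ cs'.map List.length = cs.map List.length ∧ cs'.flatten = w ∧
      ∀ d' ∈ cs'.head?, ∃ d ∈ cs.head?, d = d' ∨
        (ce i d = some d' ∧ cphi i cs.flatten = 0) := by
  induction cs with
  | nil => intro _ w h; simp [ce] at h
  | cons c cs ih =>
    intro hg w h
    rw [good_cons] at hg
    obtain ⟨g1, g2, g3⟩ := hg
    rw [List.flatten_cons, ce_append] at h
    split_ifs at h with hlt
    · simp only [Option.map_eq_some_iff] at h
      obtain ⟨c', hc', rfl⟩ := h
      have hcc : Compat c' c := compat_of_cf ((ce_iff_cf i c c').1 hc')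
      have hlen := (cf_mem i c' c ((ce_iff_cf i c c').1 hc')).2.1
      refine ⟨c' :: cs, ?_, by simp [hlen], by simp, ?_⟩
      · rw [good_cons]
        exact ⟨ce_sorted i c c' g1 hc', fun d hd => hcc.trans (g2 d hd), g3⟩
      · intro d' hd'
        simp only [List.head?_cons, Option.mem_def, Option.some.injEq] at hd'
        subst hd'
        refine ⟨c, by simp, Or.inr ⟨hc', ?_⟩⟩
        rw [List.flatten_cons, cphi_append]
        have hcp := (ce_stats i c c' hc').2.1
        rw [(col_stats i c g1).2] at hcp hlt
        rw [(col_stats i c g1).1, (col_stats i c g1).2]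
        split_ifs at * <;> first | omega | (exfalso; tauto)
    · simp only [Option.map_eq_some_iff] at h
      obtain ⟨s, hs, rfl⟩ := h
      obtain ⟨cs', k1, k2, k3, k4⟩ := ih g3 s hs
      refine ⟨c :: cs', ?_, by simp [k2], by simp [k3], ?_⟩
      · rw [good_cons]
        refine ⟨g1, ?_, k1⟩
        intro d' hd'
        obtain ⟨d, hd, hdd⟩ := k4 d' hd'
        rcases hdd with rfl | ⟨hdd, hph⟩
        · exact g2 d hd
        · have hd0 : d.Pairwise (· > ·) := g3.1 d (List.mem_of_mem_head? hd)
          exact compat_ce g1 hd0 (g2 d hd) hdd (by omega)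
      · intro d' hd'
        simp only [List.head?_cons, Option.mem_def, Option.some.injEq] at hd'
        subst hd'
        exact ⟨c, by simp, Or.inl rfl⟩

/-! ### The unique highest weight tableau -/

theorem eq_scol (c : List ℕ) : c.Pairwise (· > ·) → (∀ x ∈ c, 1 ≤ x) →
    (∀ i, 1 ≤ i → i + 1 ∈ c → i ∈ c) → c = scol c.length := by
  induction c with
  | nil => intro _ _ _; rfl
  | cons a t ih =>
    intro h1 h2 h3
    rw [List.pairwise_cons] at h1
    have ht : t = scol t.length := by
      refine ih h1.2 (fun x hx => h2 x (by simp [hx])) ?_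
      intro i hi hit
      have := h3 i hi (by simp [hit])
      rw [List.mem_cons] at this
      rcases this with h | h
      · have := h1.1 _ hit; omega
      · exact h
    have ha : a = t.length + 1 := by
      have ha1 := h2 a (by simp)
      have hlt : t.length < a := by
        by_contra hn
        have : a ∈ t := by rw [ht, mem_scol]; omega
        have := h1.1 _ this
        omega
      by_contra hne
      have hm := h3 (a - 1) (by omega) (by simp [Nat.sub_add_cancel ha1])
      rw [List.mem_cons] at hm
      rcases hm with h | h
      · omega
      · rw [ht, mem_scol] at h
        omega
    simp only [List.length_cons, scol]
    rw [← ht, ← ha]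

theorem mem_of_cphi {i : ℕ} {w : List ℕ} (h : cphi i w ≠ 0) : i ∈ w := by
  induction w with
  | nil => simp [cphi] at h
  | cons a t ih =>
    simp only [cphi] at h
    rw [List.mem_cons]
    split_ifs at h with h1 h2
    · exact Or.inl h1.symm
    · exact Or.inr (ih (by omega))
    · exact Or.inr (ih (by omega))

theorem countP_lt_bound {c : List ℕ} (hc : c.Pairwise (· > ·)) (hp : ∀ x ∈ c, 1 ≤ x) (i : ℕ) :
    c.countP (· < i) ≤ i - 1 := by
  induction i with
  | zero => simp
  | succ i ih =>
    rw [countP_lt_succ, sorted_count hc]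
    split_ifs with h
    · have := hp i h; omega
    · omega

theorem countP_lt_scol {i k : ℕ} (h : i ≤ k) : (scol k).countP (· < i + 1) = i := by
  induction i with
  | zero =>
    rw [List.countP_eq_zero]
    intro x hx
    rw [mem_scol] at hx
    simp; omega
  | succ i ih =>
    rw [countP_lt_succ, ih (by omega), sorted_count (scol_sorted k), if_pos]
    rw [mem_scol]; omega

theorem Good.pairwise {cs : List (List ℕ)} (h : Good cs) : cs.Pairwise Compat := by
  have : IsTrans (List ℕ) Compat := ⟨fun _ _ _ h h' => h.trans h'⟩
  exact List.isChain_iff_pairwise.1 h.2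

theorem good_hw (m : ℕ) (cs : List (List ℕ)) : Good cs → IsWordOver m cs.flatten →
    IsHW m cs.flatten → ∀ c ∈ cs, c = scol c.length := by
  induction cs with
  | nil => intro _ _ _ c hc; simp at hc
  | cons c cs ih =>
    intro hg hw hh
    have hpw := hg.pairwise
    rw [good_cons] at hg
    rw [List.pairwise_cons] at hpw
    obtain ⟨g1, g2, g3⟩ := hg
    rw [List.flatten_cons] at hw hh
    have hrest : ∀ d ∈ cs, d = scol d.length := by
      refine ih g3 (fun x hx => hw x (by simp only [List.mem_append]; exact Or.inr hx)) ?_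
      intro i h1 h2
      have := hh i h1 h2
      rw [ceps_append] at this
      omega
    intro d hd
    rw [List.mem_cons] at hd
    rcases hd with rfl | hd
    · have hpos : ∀ x ∈ d, 1 ≤ x ∧ x ≤ m :=
        fun x hx => hw x (by simp only [List.mem_append]; exact Or.inl hx)
      refine eq_scol d g1 (fun x hx => (hpos x hx).1) ?_
      intro i hi hid
      by_contra hni
      have him := (hpos _ hid).2
      have := hh i hi (by omega)
      rw [ceps_append, (col_stats i d g1).2, if_pos ⟨hid, hni⟩] at this
      have hmem := mem_of_cphi (i := i) (w := cs.flatten) (by omega)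
      rw [List.mem_flatten] at hmem
      obtain ⟨b, hb, hib⟩ := hmem
      rw [hrest b hb, mem_scol] at hib
      have hcb := hpw.1 b hb (i + 1)
      rw [hrest b hb, countP_lt_scol hib.2, countP_lt_succ, sorted_count g1, if_neg hni] at hcb
      have := countP_lt_bound g1 (fun x hx => (hpos x hx).1) i
      omega
    · exact hrest d hd

/-- Column words of semistandard tableaux with column heights `H`. -/
def Tab (m : ℕ) (H : List ℕ) (w : List ℕ) : Prop :=
  ∃ cs : List (List ℕ), Good cs ∧ cs.map List.length = H ∧ cs.flatten = w ∧ IsWordOver m w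

theorem tab_hw {m : ℕ} {H w : List ℕ} (h : Tab m H w) (hh : IsHW m w) : w = sword H := by
  obtain ⟨cs, h1, rfl, rfl, h4⟩ := h
  have := good_hw m cs h1 h4 hh
  unfold sword
  congr 1
  rw [List.map_map]
  conv_lhs => rw [← List.map_id cs]
  exact List.map_congr_left this

theorem word_cf {m i : ℕ} {w w' : List ℕ} (h2 : i < m)
    (hw : IsWordOver m w) (h : cf i w = some w') : IsWordOver m w' := by
  intro x hx
  rcases (cf_mem i w w' h).1 x hx with h' | h'
  · exact hw x h'
  · omega

theorem word_ce {m i : ℕ} {w w' : List ℕ} (h1 : 1 ≤ i) (h2 : i < m)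
    (hw : IsWordOver m w) (h : ce i w = some w') : IsWordOver m w' := by
  intro x hx
  rcases ce_mem i w w' h x hx with h' | h'
  · exact hw x h'
  · omega

theorem tab_ce {m i : ℕ} {H w w' : List ℕ} (h1 : 1 ≤ i) (h2 : i < m) (h : Tab m H w)
    (he : ce i w = some w') : Tab m H w' := by
  obtain ⟨cs, g1, g2, rfl, g4⟩ := h
  obtain ⟨cs', k1, k2, k3, _⟩ := good_ce i cs g1 w' he
  exact ⟨cs', k1, k2.trans g2, k3, word_ce h1 h2 g4 he⟩

theorem tab_cf {m i : ℕ} {H w w' : List ℕ} (h2 : i < m) (h : Tab m H w)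
    (he : cf i w = some w') : Tab m H w' := by
  obtain ⟨cs, g1, g2, rfl, g4⟩ := h
  obtain ⟨cs', k1, k2, k3, _⟩ := good_cf i cs g1 w' he
  exact ⟨cs', k1, k2.trans g2, k3, word_cf h2 g4 he⟩

theorem scol_sublist {a b : ℕ} (h : b ≤ a) : (scol b).Sublist (scol a) := by
  induction a with
  | zero => obtain rfl : b = 0 := by omega
            exact List.Sublist.refl _
  | succ a ih =>
    by_cases hb : b = a + 1
    · subst hb; exact List.Sublist.refl _
    · exact (ih (by omega)).cons _

theorem tab_sword {m : ℕ} {H : List ℕ} (hH : H.Pairwise (· ≥ ·)) (hw : IsWordOver m (sword H)) :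
    Tab m H (sword H) := by
  refine ⟨H.map scol, ⟨?_, ?_⟩, ?_, rfl, hw⟩
  · intro c hc
    rw [List.mem_map] at hc
    obtain ⟨k, _, rfl⟩ := hc
    exact scol_sorted k
  · apply List.Pairwise.isChain
    rw [List.pairwise_map]
    exact hH.imp (fun h k => (scol_sublist h).countP_le)
  · rw [List.map_map]
    conv_rhs => rw [← List.map_id H]
    exact List.map_congr_left (fun x _ => scol_length x)

/-! ### Components -/

theorem wordEdge_iff {m : ℕ} {u w : List ℕ} :
    wordEdge m u w ↔ ∃ i, 1 ≤ i ∧ i < m ∧ (cf i u = some w ∨ ce i u = some w) := by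
  unfold wordEdge
  simp only [Fop_eq, ce_iff_cf]

theorem wordComp_symm {m : ℕ} {u w : List ℕ} (h : wordComp m u w) : wordComp m w u := by
  have hs : Std.Symm (wordEdge m) := ⟨by
    rintro a b ⟨i, h1, h2, h3⟩
    exact ⟨i, h1, h2, h3.symm⟩⟩
  exact Std.Symm.symm (r := Relation.ReflTransGen (wordEdge m)) _ _ h

theorem tab_comp {m : ℕ} {H u w : List ℕ} (h : wordComp m u w) (hu : Tab m H u) : Tab m H w := by
  induction h with
  | refl => exact hu
  | tail _ he ih =>
    obtain ⟨i, h1, h2, h3 | h3⟩ := wordEdge_iff.1 he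
    · exact tab_cf h2 ih h3
    · exact tab_ce h1 h2 ih h3

theorem keq_comp {m : ℕ} {u u' w : List ℕ} (h : wordComp m u u') (hk : KEq u w) :
    ∃ w', wordComp m w w' ∧ KEq u' w' := by
  induction h with
  | refl => exact ⟨w, Relation.ReflTransGen.refl, hk⟩
  | tail _ he ih =>
    obtain ⟨w', hw', hk'⟩ := ih
    obtain ⟨i, h1, h2, h3 | h3⟩ := wordEdge_iff.1 he
    · obtain ⟨w'', e1, e2⟩ := hk'.cf_some h3
      exact ⟨w'', hw'.tail (wordEdge_iff.2 ⟨i, h1, h2, Or.inl e1⟩), e2⟩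
    · obtain ⟨w'', e1, e2⟩ := hk'.ce_some h3
      exact ⟨w'', hw'.tail (wordEdge_iff.2 ⟨i, h1, h2, Or.inr e1⟩), e2⟩

theorem keq_hw {m : ℕ} {u w : List ℕ} (hk : KEq u w) (h : IsHW m u) : IsHW m w := by
  intro i h1 h2
  rw [← (hk.bisim i).2.1]
  exact h i h1 h2

theorem exists_ce_of_not_hw {m : ℕ} {w : List ℕ} (h : ¬ IsHW m w) :
    ∃ i w', 1 ≤ i ∧ i < m ∧ ce i w = some w' := by
  unfold IsHW at h
  push Not at h
  obtain ⟨i, h1, h2, h3⟩ := h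
  obtain ⟨w', hw'⟩ := Option.ne_none_iff_exists'.1 (fun h => h3 ((ce_none_iff i w).1 h))
  exact ⟨i, w', h1, h2, hw'⟩

theorem keq_eq {m : ℕ} (A : List ℕ → Prop)
    (hcl : ∀ w w' i, 1 ≤ i → i < m → A w → ce i w = some w' → A w')
    (hu : ∀ w w', A w → A w' → IsHW m w → IsHW m w' → w = w') :
    ∀ N w w', w.sum ≤ N → A w → A w' → KEq w w' → w = w' := by
  intro N
  induction N with
  | zero =>
    intro w w' hs hA hA' hk
    by_cases hh : IsHW m w
    · exact hu w w' hA hA' hh (keq_hw hk hh)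
    · obtain ⟨i, w1, h1, h2, h3⟩ := exists_ce_of_not_hw hh
      have := ce_sum i w w1 h3
      omega
  | succ N ih =>
    intro w w' hs hA hA' hk
    by_cases hh : IsHW m w
    · exact hu w w' hA hA' hh (keq_hw hk hh)
    · obtain ⟨i, w1, h1, h2, h3⟩ := exists_ce_of_not_hw hh
      have := ce_sum i w w1 h3
      obtain ⟨w1', h4, h5⟩ := hk.ce_some h3
      have heq := ih w1 w1' (by omega) (hcl _ _ i h1 h2 hA h3) (hcl _ _ i h1 h2 hA' h4) h5
      subst heq
      have e1 := (ce_iff_cf i w w1).1 h3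
      have e2 := (ce_iff_cf i w' w1).1 h4
      rw [e1] at e2
      exact Option.some.inj e2

theorem exists_hw_above {m : ℕ} : ∀ N (w : List ℕ), w.sum ≤ N →
    ∃ w', wordComp m w w' ∧ IsHW m w' := by
  intro N
  induction N with
  | zero =>
    intro w hs
    by_cases hh : IsHW m w
    · exact ⟨w, Relation.ReflTransGen.refl, hh⟩
    · obtain ⟨i, w1, h1, h2, h3⟩ := exists_ce_of_not_hw hh
      have := ce_sum i w w1 h3
      omega
  | succ N ih =>
    intro w hs
    by_cases hh : IsHW m w
    · exact ⟨w, Relation.ReflTransGen.refl, hh⟩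
    · obtain ⟨i, w1, h1, h2, h3⟩ := exists_ce_of_not_hw hh
      have := ce_sum i w w1 h3
      obtain ⟨w', h4, h5⟩ := ih w1 (by omega)
      exact ⟨w', Relation.ReflTransGen.head (wordEdge_iff.2 ⟨i, h1, h2, Or.inr h3⟩) h4, h5⟩

theorem wordEdge_cons {m a : ℕ} {t w : List ℕ} (h : wordEdge m (a :: t) w) :
    ∃ b s, w = b :: s ∧ (t = s ∨ wordEdge m t s) := by
  obtain ⟨i, h1, h2, h3⟩ := wordEdge_iff.1 h
  rcases h3 with h3 | h3
  · simp only [cf] at h3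
    split_ifs at h3
    · exact ⟨_, _, (Option.some.inj h3).symm, Or.inl rfl⟩
    · simp only [Option.map_eq_some_iff] at h3
      obtain ⟨s, hs, rfl⟩ := h3
      exact ⟨_, _, rfl, Or.inr (wordEdge_iff.2 ⟨i, h1, h2, Or.inl hs⟩)⟩
  · simp only [ce] at h3
    split_ifs at h3
    · exact ⟨_, _, (Option.some.inj h3).symm, Or.inl rfl⟩
    · simp only [Option.map_eq_some_iff] at h3
      obtain ⟨s, hs, rfl⟩ := h3
      exact ⟨_, _, rfl, Or.inr (wordEdge_iff.2 ⟨i, h1, h2, Or.inr hs⟩)⟩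

theorem wordComp_cons {m a : ℕ} {t w : List ℕ} (h : wordComp m (a :: t) w) :
    ∃ b s, w = b :: s ∧ wordComp m t s := by
  induction h with
  | refl => exact ⟨a, t, rfl, Relation.ReflTransGen.refl⟩
  | tail _ he ih =>
    obtain ⟨b, s, rfl, hs⟩ := ih
    obtain ⟨b', s', rfl, hs'⟩ := wordEdge_cons he
    refine ⟨b', s', rfl, ?_⟩
    rcases hs' with rfl | hs'
    · exact hs
    · exact hs.tail hs'

theorem wordComp_nil {m : ℕ} {w : List ℕ} (h : wordComp m [] w) : w = [] := by
  induction h with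
  | refl => rfl
  | tail _ he ih =>
    subst ih
    obtain ⟨i, h1, h2, h3⟩ := wordEdge_iff.1 he
    simp [cf, ce] at h3

theorem hw_unique {m : ℕ} (v : List ℕ) : IsWordOver m v → IsHW m v →
    ∀ v', wordComp m v v' → IsHW m v' → v = v' := by
  induction v with
  | nil => intro _ _ v' h _; exact (wordComp_nil h).symm
  | cons a t ih =>
    intro hw hh v' hc hh'
    have hperm : (a :: t).Perm v' := by
      obtain ⟨H, k1, k2, k3⟩ := hw_keq_sword m _ hw hh
      have hws : IsWordOver m (sword H) := fun x hx => hw x (k3.perm.mem_iff.2 hx)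
      obtain ⟨T, hT, hk⟩ := keq_comp hc k3
      have := tab_hw (tab_comp hT (tab_sword k1 hws)) (keq_hw hk hh')
      subst this
      exact k3.perm.trans hk.perm.symm
    obtain ⟨b, s, rfl, hs⟩ := wordComp_cons hc
    have hts : t = s := ih (fun x hx => hw x (by simp [hx])) hh.tail s hs hh'.tail
    subst hts
    have hab : a = b := by
      have := hperm.sum_eq
      simpa using this
    rw [hab]

/-! ### Tableaux as functions -/

/-- The columns (bottom to top) of a tableau function. -/
def colsOf (H : List ℕ) (S : ℕ → ℕ → ℕ) : List (List ℕ) :=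
  (List.range H.length).map fun c => ((List.range (H.getD c 0)).map fun r => S r c).reverse

/-- The tableau function with given columns. -/
def tabOf (cs : List (List ℕ)) (r c : ℕ) : ℕ := (cs.getD c []).reverse.getD r 0

theorem colsOf_length (H : List ℕ) (S : ℕ → ℕ → ℕ) : (colsOf H S).map List.length = H := by
  apply List.ext_getElem
  · simp [colsOf]
  · intro n h1 h2
    simp [colsOf, List.getElem?_eq_getElem h2]

theorem getD_length (cs : List (List ℕ)) (c : ℕ) :
    (cs.getD c []).length = (cs.map List.length).getD c 0 := by
  simp only [List.getD_eq_getElem?_getD, List.getElem?_map]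
  cases cs[c]? <;> simp

theorem colsOf_getD (H : List ℕ) (S : ℕ → ℕ → ℕ) (c : ℕ) :
    (colsOf H S).getD c [] = ((List.range (H.getD c 0)).map fun r => S r c).reverse := by
  by_cases hc : c < H.length
  · simp [colsOf, hc]
  · simp [colsOf, hc]

theorem tabOf_colsOf (H : List ℕ) (S : ℕ → ℕ → ℕ) (h0 : ∀ r c, ¬ r < H.getD c 0 → S r c = 0) :
    tabOf (colsOf H S) = S := by
  funext r c
  unfold tabOf
  rw [colsOf_getD, List.reverse_reverse]
  by_cases h : r < H.getD c 0
  · rw [List.getD_eq_getElem _ _ (by simpa using h)]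
    simp
  · rw [List.getD_eq_default _ _ (by simpa using h), h0 r c h]

theorem colsOf_tabOf (cs : List (List ℕ)) : colsOf (cs.map List.length) (tabOf cs) = cs := by
  apply List.ext_getElem
  · simp [colsOf]
  · intro n h1 h2
    have e : (colsOf (cs.map List.length) (tabOf cs)).getD n [] = cs.getD n [] := by
      rw [colsOf_getD, ← getD_length]
      rw [List.reverse_eq_iff]
      apply List.ext_getElem
      · simp
      · intro k k1 k2
        simp only [List.getElem_map, List.getElem_range, tabOf]
        rw [List.getD_eq_getElem _ _ k2]
    rw [List.getD_eq_getElem _ _ h1, List.getD_eq_getElem _ _ h2] at e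
    exact e

theorem countP_ge_iff (H : List ℕ) (hH : H.Pairwise (· ≥ ·)) (r : ℕ) : ∀ c,
    c < H.countP (r + 1 ≤ ·) ↔ r < H.getD c 0 := by
  induction H with
  | nil => intro c; simp
  | cons h H ih =>
    rw [List.pairwise_cons] at hH
    intro c
    have ih' := ih hH.2
    rw [List.countP_cons]
    by_cases hr : r + 1 ≤ h
    · cases c with
      | zero => simp [hr]; omega
      | succ c =>
        have := ih' c
        simp only [List.getD_cons_succ, hr, decide_true, if_true]
        omega
    · have h0 : H.countP (r + 1 ≤ ·) = 0 := by
        rw [List.countP_eq_zero]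
        intro x hx
        have := hH.1 x hx
        simp; omega
      cases c with
      | zero => simp only [List.getD_cons_zero, h0, hr]; simp; omega
      | succ c =>
        have := ih' c
        rw [h0] at this ⊢
        simp only [List.getD_cons_succ, hr]
        simp at this ⊢
        omega

theorem countP_lt_iff (L : List ℕ) (hL : L.Pairwise (· < ·)) (k : ℕ) : ∀ r, r < L.length →
    (r < L.countP (· < k) ↔ L.getD r 0 < k) := by
  induction L with
  | nil => intro r hr; simp at hr
  | cons a L ih =>
    rw [List.pairwise_cons] at hL
    intro r hr
    rw [List.countP_cons]
    by_cases ha : a < k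
    · cases r with
      | zero => simp [ha]
      | succ r =>
        have := ih hL.2 r (by simpa using hr)
        simp only [List.getD_cons_succ, ha, decide_true, if_true]
        omega
    · have h0 : L.countP (· < k) = 0 := by
        rw [List.countP_eq_zero]
        intro x hx
        have := hL.1 x hx
        simp; omega
      cases r with
      | zero => simp only [List.getD_cons_zero, h0, ha]; simp
      | succ r =>
        have := ih hL.2 r (by simpa using hr)
        rw [h0] at this ⊢
        simp only [List.getD_cons_succ, ha]
        simp at this ⊢
        omega

theorem getD_antitone (H : List ℕ) (hH : H.Pairwise (· ≥ ·)) (c : ℕ) :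
    H.getD (c + 1) 0 ≤ H.getD c 0 := by
  by_cases h : c + 1 < H.length
  · rw [List.getD_eq_getElem _ _ h, List.getD_eq_getElem _ _ (by omega)]
    exact List.pairwise_iff_getElem.1 hH c (c + 1) (by omega) h (by omega)
  · rw [List.getD_eq_default _ _ (by omega)]; omega

section encode

theorem tab_of_ssyt {m : ℕ} {H : List ℕ} {ν : ℕ → ℕ} (hH : H.Pairwise (· ≥ ·))
    (hν : ∀ r c, c < ν (r + 1) ↔ r < H.getD c 0) {S : ℕ → ℕ → ℕ} (hS : IsSSYTFn ν m S) :
    Good (colsOf H S) ∧ IsWordOver m (colsOf H S).flatten := by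
  obtain ⟨s1, s2, s3, s4⟩ := hS
  simp only [hν] at s1 s2 s3
  have s4' : ∀ r c, r + 1 < H.getD c 0 → S r c < S (r + 1) c :=
    fun r c h => s4 r c ((hν (r + 1) c).2 h)
  have mono : ∀ c r d, r + d + 1 < H.getD c 0 → S r c < S (r + d + 1) c := by
    intro c r d
    induction d with
    | zero => intro h; exact s4' r c h
    | succ d ih =>
      intro h
      exact (ih (by omega)).trans (s4' (r + d + 1) c h)
  refine ⟨⟨?_, ?_⟩, ?_⟩
  · intro L hL
    simp only [colsOf, List.mem_map] at hL
    obtain ⟨c, _, rfl⟩ := hL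
    rw [List.pairwise_reverse, List.pairwise_map]
    refine List.Pairwise.imp_of_mem ?_ List.pairwise_lt_range
    intro a b _ hb hab
    rw [List.mem_range] at hb
    have := mono c a (b - a - 1) (by omega)
    rwa [show a + (b - a - 1) + 1 = b by omega] at this
  · rw [List.isChain_iff_getElem]
    intro c hc k
    have hc' : c + 1 < H.length := by simpa [colsOf] using hc
    simp only [colsOf, List.getElem_map, List.getElem_range, List.countP_reverse, List.countP_map]
    refine le_trans (List.countP_mono_left (q := (fun x => decide (x < k)) ∘ fun r => S r c) ?_) ?_
    · intro r hr h
      rw [List.mem_range] at hr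
      simp only [Function.comp, decide_eq_true_eq] at h ⊢
      exact lt_of_le_of_lt (s3 r c hr) h
    · exact (List.range_sublist.2 (getD_antitone H hH c)).countP_le
  · intro x hx
    rw [List.mem_flatten] at hx
    obtain ⟨L, hL, hx⟩ := hx
    simp only [colsOf, List.mem_map] at hL
    obtain ⟨c, _, rfl⟩ := hL
    simp only [List.mem_reverse, List.mem_map, List.mem_range] at hx
    obtain ⟨r, hr, rfl⟩ := hx
    exact s2 r c hr

theorem ssyt_of_tab {m : ℕ} {H : List ℕ} {ν : ℕ → ℕ}
    (hν : ∀ r c, c < ν (r + 1) ↔ r < H.getD c 0) {cs : List (List ℕ)} (hg : Good cs)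
    (hl : cs.map List.length = H) (hw : IsWordOver m cs.flatten) : IsSSYTFn ν m (tabOf cs) := by
  subst hl
  have hlen : ∀ r c, c < ν (r + 1) ↔ r < (cs.getD c []).reverse.length := by
    intro r c
    rw [hν, List.length_reverse, getD_length]
  have hin : ∀ c, (cs.getD c []) ∈ cs ∨ cs.getD c [] = [] := by
    intro c
    by_cases h : c < cs.length
    · left; rw [List.getD_eq_getElem _ _ h]; exact List.getElem_mem h
    · right; rw [List.getD_eq_default _ _ (by omega)]
  have hsort : ∀ c, (cs.getD c []).reverse.Pairwise (· < ·) := by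
    intro c
    rw [List.pairwise_reverse]
    rcases hin c with h | h
    · exact hg.1 _ h
    · rw [h]; exact List.Pairwise.nil
  refine ⟨?_, ?_, ?_, ?_⟩
  · intro r c h
    rw [hlen] at h
    exact List.getD_eq_default _ _ (by omega)
  · intro r c h
    rw [hlen] at h
    unfold tabOf
    rw [List.getD_eq_getElem _ _ h]
    apply hw
    rw [List.mem_flatten]
    refine ⟨cs.getD c [], ?_, List.mem_reverse.1 (List.getElem_mem h)⟩
    rcases hin c with h' | h'
    · exact h'
    · rw [h'] at h; simp at h
  · intro r c h
    have hr1 := h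
    rw [hlen] at hr1
    have hc1 : c + 1 < cs.length := by
      by_contra hn
      rw [List.getD_eq_default _ _ (by omega)] at hr1
      simp at hr1
    have hcomp : Compat (cs.getD c []) (cs.getD (c + 1) []) := by
      rw [List.getD_eq_getElem _ _ hc1, List.getD_eq_getElem _ _ (by omega)]
      exact List.isChain_iff_getElem.1 hg.2 c hc1
    have hk := hcomp (tabOf cs r (c + 1) + 1)
    have e1 := (countP_lt_iff _ (hsort (c + 1)) (tabOf cs r (c + 1) + 1) r hr1).2
      (by unfold tabOf; omega)
    rw [List.countP_reverse] at e1
    have hr0 : r < (cs.getD c []).reverse.length := by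
      rw [List.length_reverse]
      exact lt_of_lt_of_le (lt_of_lt_of_le e1 hk) List.countP_le_length
    have e2 := (countP_lt_iff _ (hsort c) (tabOf cs r (c + 1) + 1) r hr0).1
      (by rw [List.countP_reverse]; omega)
    change tabOf cs r c < _ at e2
    omega
  · intro r c h
    have h' := h
    rw [hlen (r + 1)] at h'
    unfold tabOf
    rw [List.getD_eq_getElem _ _ h', List.getD_eq_getElem _ _ (by omega)]
    exact List.pairwise_iff_getElem.1 (hsort c) r (r + 1) (by omega) h' (by omega)

theorem count_colsOf {H : List ℕ} {ν : ℕ → ℕ}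
    (hν : ∀ r c, c < ν (r + 1) ↔ r < H.getD c 0) (S : ℕ → ℕ → ℕ) (j : ℕ) :
    Nat.card {p : ℕ × ℕ // p.2 < ν (p.1 + 1) ∧ S p.1 p.2 = j} =
      (colsOf H S).flatten.count j := by
  let T : Finset (Σ _ : ℕ, ℕ) := (Finset.range H.length).sigma
    fun c => (Finset.range (H.getD c 0)).filter fun r => S r c = j
  rw [Nat.subtype_card (T.image fun q => (q.2, q.1))]
  · rw [Finset.card_image_of_injective]
    · rw [Finset.card_sigma, List.count_flatten]
      simp only [colsOf, List.map_map]
      change _ = ((Multiset.range H.length).map _).sum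
      unfold Finset.sum
      congr 1
      apply Multiset.map_congr rfl
      intro c _
      simp only [Function.comp, List.count_reverse]
      rw [List.count, List.countP_map, List.countP_eq_length_filter]
      rfl
    · rintro ⟨a, b⟩ ⟨a', b'⟩ h
      simp only [Prod.mk.injEq] at h
      rw [h.1, h.2]
  · rintro ⟨r, c⟩
    simp only [T, Finset.mem_image, Finset.mem_sigma, Finset.mem_range, Finset.mem_filter,
      Prod.mk.injEq, hν]
    constructor
    · rintro ⟨⟨a, b⟩, ⟨h1, h2, h3⟩, rfl, rfl⟩
      exact ⟨h2, h3⟩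
    · rintro ⟨h1, h2⟩
      refine ⟨⟨c, r⟩, ⟨?_, h1, h2⟩, rfl, rfl⟩
      by_contra hn
      rw [List.getD_eq_default _ _ (by simpa using hn)] at h1
      omega

end encode

theorem count_sword (H : List ℕ) (k : ℕ) : (sword H).count (k + 1) = H.countP (k + 1 ≤ ·) := by
  induction H with
  | nil => simp [sword]
  | cons h H ih =>
    have : sword (h :: H) = scol h ++ sword H := by simp [sword]
    rw [this, List.count_append, ih, List.countP_cons, sorted_count (scol_sorted h)]
    simp only [mem_scol, decide_eq_true_eq]
    split_ifs <;> omega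

/-- Let `C` be a connected component of the crystal graph on `[m]^n` and `v`
its unique vertex with `E_i(v) = 0` for all `i ∈ [m-1]`. Then `∑_{u ∈ C} x^{w(u)}` equals the
Schur polynomial `s_{w(v)}(x_1, …, x_m)` of the partition `w(v) = (v.count 1, …, v.count m)`. -/
theorem component_sum_eq_schur (m n : ℕ) (hm : 1 ≤ m) (hn : 1 ≤ n)
    (v : List ℕ) (hv : v.length = n) (hv1 : IsWordOver m v)
    (hhv : ∀ i, 1 ≤ i → i < m → Eop i v = none) :
    ∑ᶠ u : {u : List ℕ // wordComp m v u},
        ∏ᶠ j : ℕ, (MvPolynomial.X j : MvPolynomial ℕ ℤ) ^ u.1.count j =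
      schurPoly (fun j => v.count j) m := by
  have hhw : IsHW m v := fun i h1 h2 => ceps_eq_zero_of_Eop i v (hhv i h1 h2)
  obtain ⟨H, k1, k2, k3⟩ := hw_keq_sword m v hv1 hhw
  have hν : ∀ r c, c < (fun j => v.count j) (r + 1) ↔ r < H.getD c 0 := by
    intro r c
    rw [← countP_ge_iff H k1 r c, ← count_sword]
    simp only [k3.perm.count_eq]
  have hws : IsWordOver m (sword H) := fun x hx => hv1 x (k3.perm.mem_iff.2 hx)
  have htab := tab_sword k1 hws
  -- every tableau word lies in the component of the superstandard word
  have tabcomp : ∀ w, Tab m H w → wordComp m (sword H) w := by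
    intro w hw
    obtain ⟨w', h1, h2⟩ := exists_hw_above (m := m) w.sum w le_rfl
    rw [tab_hw (tab_comp h1 hw) h2] at h1
    exact wordComp_symm h1
  have uniqT : ∀ w w', Tab m H w → Tab m H w' → KEq w w' → w = w' := by
    intro w w' h h' hk
    refine keq_eq (m := m) (Tab m H) (fun _ _ i h1 h2 => tab_ce h1 h2) ?_ w.sum w w' le_rfl h h' hk
    intro a b ha hb ha' hb'
    rw [tab_hw ha ha', tab_hw hb hb']
  have uniqC : ∀ w w', wordComp m v w → wordComp m v w' → KEq w w' → w = w' := by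
    intro w w' h h' hk
    refine keq_eq (m := m) (wordComp m v) ?_ ?_ w.sum w w' le_rfl h h' hk
    · intro a b i h1 h2 ha hab
      exact ha.tail (wordEdge_iff.2 ⟨i, h1, h2, Or.inr hab⟩)
    · intro a b ha hb ha' hb'
      rw [← hw_unique v hv1 hhw a ha ha', ← hw_unique v hv1 hhw b hb hb']
  have tabS : ∀ S, IsSSYTFn (fun j => v.count j) m S → Tab m H (colsOf H S).flatten := by
    intro S hS
    obtain ⟨g1, g2⟩ := tab_of_ssyt k1 hν hS
    exact ⟨_, g1, colsOf_length H S, rfl, g2⟩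
  have hex : ∀ S : {S : ℕ → ℕ → ℕ // IsSSYTFn (fun j => v.count j) m S},
      ∃ u : {u : List ℕ // wordComp m v u}, KEq (colsOf H S.1).flatten u.1 := by
    intro S
    obtain ⟨u, hu, hk⟩ := keq_comp (tabcomp _ (tabS S.1 S.2)) k3.symm
    exact ⟨⟨u, hu⟩, hk⟩
  choose g hg using hex
  have hbij : Function.Bijective g := by
    constructor
    · intro S S' h
      have hk : KEq (colsOf H S.1).flatten (colsOf H S'.1).flatten :=
        (hg S).trans (by rw [h]; exact (hg S').symm)
      have he := uniqT _ _ (tabS _ S.2) (tabS _ S'.2) hk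
      have hc : colsOf H S.1 = colsOf H S'.1 := by
        rw [List.eq_iff_flatten_eq]
        exact ⟨he, by rw [colsOf_length, colsOf_length]⟩
      have z : ∀ S : {S : ℕ → ℕ → ℕ // IsSSYTFn (fun j => v.count j) m S},
          tabOf (colsOf H S.1) = S.1 := fun S =>
        tabOf_colsOf H S.1 (fun r c h => S.2.1 r c (by rw [hν]; exact h))
      apply Subtype.ext
      rw [← z S, ← z S', hc]
    · rintro ⟨u, hu⟩
      obtain ⟨w, hw, hk⟩ := keq_comp hu k3
      obtain ⟨cs, g1, g2, g3, g4⟩ := tab_comp hw htab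
      subst g3
      refine ⟨⟨tabOf cs, ssyt_of_tab hν g1 g2 g4⟩, ?_⟩
      apply Subtype.ext
      have := hg ⟨tabOf cs, ssyt_of_tab hν g1 g2 g4⟩
      have e : colsOf H (tabOf cs) = cs := by rw [← g2]; exact colsOf_tabOf cs
      rw [e] at this
      exact uniqC _ _ (g _).2 hu (this.symm.trans hk.symm)
  unfold schurPoly
  symm
  refine finsum_eq_of_bijective g hbij ?_
  intro S
  unfold ssytMonom
  congr 1
  funext j
  rw [count_colsOf (ν := fun j => v.count j) hν S.1 j, (hg S).perm.count_eq]
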